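/- arXiv:1608.07504 — 6 statements merged into one kernel-verified Lean document; each statement's English description precedes it below -/
import Mathlib

section
/- Let H be a cocommutative Hopf algebra over ℂ and V a finite-dimensional completely reducible (semisimple) H-module. Then V admits both a nondegenerate H-invariant symmetric bilinear form and a nondegenerate H-invariant skew-symmetric bilinear form if and only if there exists a finite-dimensional H-module W such that V ≅ W ⊕ W* as H-modules, where W* is the linear dual of W equipped with the contragredient action (h·f)(w) := f(S(h)·w). -/
open TensorProduct

namespace HopfAlgebra

open Coalgebra LinearMap WithConv

/-- The antipode of a cocommutative Hopf algebra is an involution. -/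
lemma antipode_antipode_of_comm_comul {R H : Type*} [CommSemiring R] [Semiring H]
    [HopfAlgebra R H] (hcc : ∀ h : H, (TensorProduct.comm R H H) (comul h) = comul h) (h : H) :
    antipode R (antipode R h) = h := by
  have hleft : toConv (antipode R ∘ₗ antipode R (A := H)) * toConv (antipode R) = 1 := by
    ext c
    have hc : ∑ i ∈ (ℛ R c).index, (ℛ R c).right i * antipode R ((ℛ R c).left i) =
        algebraMap R H (counit c) := by
      have := mul_antipode_lTensor_comul_apply (R := R) c
      rw [← hcc c, ← (ℛ R c).eq] at this
      simpa [map_sum] using this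
    rw [(ℛ R c).convMul_apply]
    simp only [LinearMap.comp_apply, ← antipode_mul_antidistrib, ← map_sum]
    rw [hc, Algebra.algebraMap_eq_smul_one, map_smul, antipode_one]
    simp [Algebra.algebraMap_eq_smul_one]
  have heq := left_inv_eq_right_inv hleft (antipode_mul_id (R := R) (C := H))
  exact congr($(toConv_injective heq) h)

end HopfAlgebra

section Eigenspaces

variable {K V : Type*} [Field K] [AddCommGroup V] [Module K V]

/-- If `f` is skew-adjoint for `B`, the generalized eigenspaces of `f` for `μ` and `ν` are
`B`-orthogonal unless `μ + ν = 0`. -/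
lemma LinearMap.apply_eq_zero_of_mem_maxGenEigenspace {B : V →ₗ[K] V →ₗ[K] K}
    {f : Module.End K V} (hf : ∀ v w, B (f v) w = - B v (f w)) {μ ν : K} (hμν : μ + ν ≠ 0)
    {v w : V} (hv : v ∈ f.maxGenEigenspace μ) (hw : w ∈ f.maxGenEigenspace ν) : B v w = 0 := by
  rw [Module.End.mem_maxGenEigenspace] at hv hw
  obtain ⟨k, hk⟩ := hv
  obtain ⟨l, hl⟩ := hw
  induction k generalizing v w l with
  | zero => simp_all
  | succ k ihk =>
    induction l generalizing w with
    | zero => simp_all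
    | succ l ihl =>
      have hv' : B ((f - μ • 1) v) w = 0 := by
        refine ihk ?_ _ hl
        rwa [pow_succ, Module.End.mul_apply] at hk
      have hw' : B v ((f - ν • 1) w) = 0 := by
        refine ihl ?_
        rwa [pow_succ, Module.End.mul_apply] at hl
      simp only [LinearMap.sub_apply, LinearMap.smul_apply, Module.End.one_apply, map_sub,
        map_smul, smul_eq_mul, hf] at hv' hw'
      refine (mul_eq_zero.mp ?_).resolve_left hμν
      linear_combination - hv' - hw'

variable {H : Type*} [Ring H] [Algebra K H] [Module H V] [IsScalarTower K H V]

/-- The sum of the generalized eigenspaces of an `H`-linear endomorphism for eigenvalues in `s`,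
as an `H`-submodule. -/
def LinearMap.sumMaxGenEigenspace (f : V →ₗ[H] V) (s : Set K) : Submodule H V where
  __ := ⨆ μ ∈ s, Module.End.maxGenEigenspace (f.restrictScalars K : Module.End K V) μ
  smul_mem' h v hv := by
    have hcomm : Commute (f.restrictScalars K : Module.End K V) (Algebra.lsmul K K V h) := by
      ext v
      simp
    have hle : (⨆ μ ∈ s, Module.End.maxGenEigenspace (f.restrictScalars K : Module.End K V) μ) ≤
        (⨆ μ ∈ s, Module.End.maxGenEigenspace (f.restrictScalars K : Module.End K V) μ).comap
          (Algebra.lsmul K K V h) :=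
      iSup₂_le fun μ hμ v hv ↦ Submodule.mem_iSup_of_mem μ <| Submodule.mem_iSup_of_mem hμ <|
        Module.End.mapsTo_maxGenEigenspace_of_comm hcomm μ hv
    exact hle hv

lemma LinearMap.mem_sumMaxGenEigenspace {f : V →ₗ[H] V} {s : Set K} {v : V} :
    v ∈ f.sumMaxGenEigenspace s ↔
      v ∈ ⨆ μ ∈ s, Module.End.maxGenEigenspace (f.restrictScalars K : Module.End K V) μ :=
  Iff.rfl

lemma LinearMap.apply_eq_zero_of_mem_sumMaxGenEigenspace {B : V →ₗ[K] V →ₗ[K] K}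
    {f : V →ₗ[H] V} (hf : ∀ v w, B (f v) w = - B v (f w)) {s : Set K}
    (hs : ∀ μ ∈ s, ∀ ν ∈ s, μ + ν ≠ 0) {v w : V} (hv : v ∈ f.sumMaxGenEigenspace s)
    (hw : w ∈ f.sumMaxGenEigenspace s) : B v w = 0 := by
  rw [mem_sumMaxGenEigenspace] at hv hw
  have hle : (⨆ μ ∈ s, Module.End.maxGenEigenspace (f.restrictScalars K : Module.End K V) μ) ≤
      LinearMap.ker (B.flip w) := by
    refine iSup₂_le fun μ hμ v hv ↦ ?_
    have hle' : (⨆ μ ∈ s, Module.End.maxGenEigenspace (f.restrictScalars K : Module.End K V) μ) ≤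
        LinearMap.ker (B v) :=
      iSup₂_le fun ν hν w hw ↦
        LinearMap.apply_eq_zero_of_mem_maxGenEigenspace (f := f.restrictScalars K) hf
          (hs μ hμ ν hν) hv hw
    exact hle' hw
  exact hle hv

lemma LinearMap.sumMaxGenEigenspace_sup_eq_top [IsAlgClosed K] [FiniteDimensional K V]
    {f : V →ₗ[H] V} (hf : Function.Injective f) {s t : Set K} (hst : ∀ μ ≠ 0, μ ∈ s ∨ μ ∈ t) :
    f.sumMaxGenEigenspace s ⊔ f.sumMaxGenEigenspace t = ⊤ := by
  rw [eq_top_iff]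
  intro v _
  have hle : (⊤ : Submodule K V) ≤
      (f.sumMaxGenEigenspace s ⊔ f.sumMaxGenEigenspace t).restrictScalars K := by
    rw [← Module.End.iSup_maxGenEigenspace_eq_top (f.restrictScalars K : Module.End K V)]
    refine iSup_le fun μ v hv ↦ ?_
    rcases eq_or_ne μ 0 with rfl | hμ
    · obtain ⟨k, hk⟩ := (Module.End.mem_maxGenEigenspace _ _ _).mp hv
      have hv0 : v = 0 := by
        rw [zero_smul, sub_zero, Module.End.pow_apply] at hk
        refine hf.iterate k (hk.trans ?_)
        exact (iterate_map_zero f k).symm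
      rw [hv0]
      exact zero_mem _
    · rcases hst μ hμ with h | h
      · exact Submodule.mem_sup_left <| mem_sumMaxGenEigenspace.mpr <|
          Submodule.mem_iSup_of_mem μ <| Submodule.mem_iSup_of_mem h hv
      · exact Submodule.mem_sup_right <| mem_sumMaxGenEigenspace.mpr <|
          Submodule.mem_iSup_of_mem μ <| Submodule.mem_iSup_of_mem h hv
  exact hle (Submodule.mem_top (x := v))

end Eigenspaces

/-- A set of representatives of the nonzero complex numbers modulo sign. -/
def Complex.halfPlane : Set ℂ := {z | 0 < z.re ∨ z.re = 0 ∧ 0 < z.im}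

lemma Complex.add_ne_zero_of_mem_halfPlane {z w : ℂ} (hz : z ∈ halfPlane) (hw : w ∈ halfPlane) :
    z + w ≠ 0 := by
  intro h
  have hre := congrArg Complex.re h
  have him := congrArg Complex.im h
  simp only [Complex.add_re, Complex.add_im, Complex.zero_re, Complex.zero_im] at hre him
  rcases hz with hz | ⟨hz, hz'⟩ <;> rcases hw with hw | ⟨hw, hw'⟩ <;> linarith

lemma Complex.mem_halfPlane_or_neg_mem {z : ℂ} (hz : z ≠ 0) :
    z ∈ halfPlane ∨ -z ∈ halfPlane := by
  simp only [halfPlane, Set.mem_ofPred_eq, Complex.neg_re, Complex.neg_im]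
  rcases lt_trichotomy z.re 0 with h | h | h
  · exact .inr (.inl (by linarith))
  · rcases lt_trichotomy z.im 0 with h' | h' | h'
    · exact .inr (.inr ⟨by linarith, by linarith⟩)
    · exact absurd (Complex.ext h h') hz
    · exact .inl (.inr ⟨h, h'⟩)
  · exact .inl (.inl h)

section InvariantForms

variable {H V : Type*} [Ring H] [HopfAlgebra ℂ H] [AddCommGroup V] [Module ℂ V] [Module H V]

/-- If `V` is the direct sum of two submodules isotropic for a nondegenerate invariant form,
then it is isomorphic to the sum of the first one and its dual. -/
lemma exists_equiv_prod_dual_of_isCompl [IsScalarTower ℂ H V] [FiniteDimensional ℂ V]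
    {B : V →ₗ[ℂ] V →ₗ[ℂ] ℂ} (hB : B.Nondegenerate)
    (hinv : ∀ (h : H) (v w : V), B (h • v) w = B v (HopfAlgebra.antipode (R := ℂ) h • w))
    {W W' : Submodule H V} (hW : IsCompl W W') (hiso : ∀ v ∈ W, ∀ w ∈ W, B v w = 0)
    (hiso' : ∀ v ∈ W', ∀ w ∈ W', B v w = 0) :
    ∃ e : V ≃ₗ[ℂ] W × (W →ₗ[ℂ] ℂ), ∀ (h : H) (v : V), (e (h • v)).1 = h • (e v).1 ∧
      ∀ w : W, (e (h • v)).2 w = (e v).2 (HopfAlgebra.antipode (R := ℂ) h • w) := by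
  have hinj : Function.Injective B :=
    LinearMap.ker_eq_bot.mp (LinearMap.separatingLeft_iff_ker_eq_bot.mp hB.1)
  have hsurj : Function.Surjective B :=
    (LinearMap.injective_iff_surjective_of_finrank_eq_finrank
      Subspace.dual_finrank_eq.symm).mp hinj
  let π : V →ₗ[H] W := W.projectionOnto W' hW
  have hsub (v : V) : v - π v ∈ W' := by
    rw [← Submodule.ker_projectionOnto hW, LinearMap.mem_ker, map_sub, sub_eq_zero]
    exact (Submodule.projectionOnto_apply_left hW (π v)).symm
  let φ : V →ₗ[ℂ] W × (W →ₗ[ℂ] ℂ) :=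
    (π.restrictScalars ℂ).prod ((LinearMap.lcomp ℂ ℂ (W.subtype.restrictScalars ℂ)).comp B)
  have hφ₁ (v : V) : (φ v).1 = π v := rfl
  have hφ₂ (v : V) (w : W) : (φ v).2 w = B v w := rfl
  have hφinj : Function.Injective φ := by
    rw [injective_iff_map_eq_zero]
    intro v hv
    have hvW' : v ∈ W' := by
      have h := hsub v
      rwa [← hφ₁, hv, Prod.fst_zero, ZeroMemClass.coe_zero, sub_zero] at h
    refine hB.1 v fun u ↦ ?_
    have hπu : B v (π u) = 0 := by rw [← hφ₂, hv]; rfl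
    rw [← add_sub_cancel (π u : V) u, map_add, hπu, hiso' v hvW' _ (hsub u), add_zero]
  have hφsurj : Function.Surjective φ := by
    rintro ⟨w, f⟩
    obtain ⟨u, hu⟩ := hsurj (f ∘ₗ π.restrictScalars ℂ)
    have hπ (w : W) : π w = w := Submodule.projectionOnto_apply_left hW w
    refine ⟨w + (u - π u), Prod.ext ?_ (LinearMap.ext fun x ↦ ?_)⟩
    · simp [hφ₁, hπ]
    · rw [hφ₂, map_add, map_sub, LinearMap.add_apply, LinearMap.sub_apply,
        hiso _ w.2 _ x.2, hiso _ (π u).2 _ x.2, hu]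
      simp [hπ]
  refine ⟨LinearEquiv.ofBijective φ ⟨hφinj, hφsurj⟩, fun h v ↦ ⟨?_, fun w ↦ ?_⟩⟩
  · exact map_smul π h v
  · exact hinv h v w

/-- Two invariant forms, the first of them nondegenerate, differ by an `H`-linear endomorphism. -/
lemma exists_linearMap_of_invariant [FiniteDimensional ℂ V] {B C : V →ₗ[ℂ] V →ₗ[ℂ] ℂ}
    (hB : B.Nondegenerate)
    (hBinv : ∀ (h : H) (v w : V), B (h • v) w = B v (HopfAlgebra.antipode (R := ℂ) h • w))
    (hCinv : ∀ (h : H) (v w : V), C (h • v) w = C v (HopfAlgebra.antipode (R := ℂ) h • w)) :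
    ∃ f : V →ₗ[H] V, ∀ v w, B (f v) w = C v w := by
  have hinj : Function.Injective B :=
    LinearMap.ker_eq_bot.mp (LinearMap.separatingLeft_iff_ker_eq_bot.mp hB.1)
  let E : V ≃ₗ[ℂ] (V →ₗ[ℂ] ℂ) :=
    LinearMap.linearEquivOfInjective B hinj Subspace.dual_finrank_eq.symm
  have hE (v w : V) : B (E.symm (C v)) w = C v w := congr($(E.apply_symm_apply (C v)) w)
  refine ⟨{ toFun := fun v ↦ E.symm (C v), map_add' := by simp, map_smul' := fun h v ↦ ?_ }, hE⟩
  refine hinj (LinearMap.ext fun w ↦ ?_)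
  rw [hE, hCinv, RingHom.id_apply, hBinv, hE]

/-- For `c = 1` or `c = -1`, the transport to `V` of the pairing `f(w') + c f'(w)` on `W ⊕ W*`
is nondegenerate, invariant and `c`-symmetric. -/
lemma exists_invariant_form_of_equiv_prod_dual [IsScalarTower ℂ H V]
    (hcc : ∀ h : H, (TensorProduct.comm ℂ H H) (Coalgebra.comul h) = Coalgebra.comul h)
    {W : Submodule H V} (e : V ≃ₗ[ℂ] W × (W →ₗ[ℂ] ℂ))
    (he : ∀ (h : H) (v : V), (e (h • v)).1 = h • (e v).1 ∧
      ∀ w : W, (e (h • v)).2 w = (e v).2 (HopfAlgebra.antipode (R := ℂ) h • w))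
    {c : ℂ} (hc : c * c = 1) :
    ∃ B : V →ₗ[ℂ] V →ₗ[ℂ] ℂ, B.Nondegenerate ∧ (∀ v w : V, B v w = c * B w v) ∧
      ∀ (h : H) (v w : V), B (h • v) w = B v (HopfAlgebra.antipode (R := ℂ) h • w) := by
  let B : V →ₗ[ℂ] V →ₗ[ℂ] ℂ := LinearMap.mk₂ ℂ
    (fun v w ↦ (e v).2 (e w).1 + c * (e w).2 (e v).1)
    (fun _ _ _ ↦ by simp; ring) (fun _ _ _ ↦ by simp; ring)
    (fun _ _ _ ↦ by simp; ring) (fun _ _ _ ↦ by simp; ring)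
  have hB (v w : V) : B v w = (e v).2 (e w).1 + c * (e w).2 (e v).1 := rfl
  have hc0 : c ≠ 0 := left_ne_zero_of_mul_eq_one hc
  have hsymm (v w : V) : B v w = c * B w v := by
    rw [hB, hB]
    linear_combination - (e v).2 (e w).1 * hc
  have hleft : B.SeparatingLeft := by
    intro v hv
    rw [← e.map_eq_zero_iff]
    refine Prod.ext ?_ (LinearMap.ext fun w ↦ ?_)
    · refine (Module.forall_dual_apply_eq_zero_iff ℂ _).mp fun f ↦ ?_
      simpa [hB, hc0] using hv (e.symm (0, f))
    · simpa [hB] using hv (e.symm (w, 0))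
  refine ⟨B, ⟨hleft, fun w hw ↦ hleft w fun v ↦ ?_⟩, hsymm, fun h v w ↦ ?_⟩
  · rw [hsymm, hw, mul_zero]
  · rw [hB, hB, (he h v).1, (he h v).2, (he _ w).1, (he _ w).2,
      HopfAlgebra.antipode_antipode_of_comm_comul hcc]

end InvariantForms

/-- Let `H` be a cocommutative Hopf algebra over `ℂ` and `V` a
finite-dimensional completely reducible `H`-module.  Then `V` admits both a nondegenerate
`H`-invariant symmetric bilinear form and a nondegenerate `H`-invariant skew-symmetric
bilinear form if and only if `V ≅ W ⊕ W*` for some finite-dimensional `H`-module `W`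
(which may be taken to be an `H`-submodule of `V`), where the dual `W*` carries the
contragredient action `(h·f)(w) = f(S(h)·w)`. -/
theorem stmt_0 (H V : Type*) [Ring H] [HopfAlgebra ℂ H]
    -- cocommutativity of `H`
    (hcc : ∀ h : H, (TensorProduct.comm ℂ H H) (Coalgebra.comul h) = Coalgebra.comul h)
    [AddCommGroup V] [Module ℂ V] [Module H V] [IsScalarTower ℂ H V]
    [FiniteDimensional ℂ V] [IsSemisimpleModule H V] :
    ((∃ B : V →ₗ[ℂ] V →ₗ[ℂ] ℂ, B.Nondegenerate ∧ (∀ v w : V, B v w = B w v) ∧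
        ∀ (h : H) (v w : V), B (h • v) w = B v (HopfAlgebra.antipode (R := ℂ) h • w)) ∧
      (∃ B : V →ₗ[ℂ] V →ₗ[ℂ] ℂ, B.Nondegenerate ∧ (∀ v w : V, B v w = - B w v) ∧
        ∀ (h : H) (v w : V), B (h • v) w = B v (HopfAlgebra.antipode (R := ℂ) h • w)))
    ↔
    (∃ (W : Submodule H V) (e : V ≃ₗ[ℂ] W × (W →ₗ[ℂ] ℂ)),
      ∀ (h : H) (v : V),
        (e (h • v)).1 = h • (e v).1 ∧
        ∀ w : W, (e (h • v)).2 w = (e v).2 (HopfAlgebra.antipode (R := ℂ) h • w)) := by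
  constructor
  · rintro ⟨⟨B, hB, hBsymm, hBinv⟩, C, hC, hCskew, hCinv⟩
    obtain ⟨f, hf⟩ := exists_linearMap_of_invariant hB hBinv hCinv
    have hskew (v w : V) : B (f v) w = - B v (f w) := by
      rw [hf, hCskew, ← hf, hBsymm]
    have hinj : Function.Injective f := by
      rw [injective_iff_map_eq_zero]
      intro v hv
      refine hC.1 v fun w ↦ ?_
      rw [← hf, hv, map_zero, LinearMap.zero_apply]
    have hiso : ∀ v ∈ f.sumMaxGenEigenspace Complex.halfPlane,
        ∀ w ∈ f.sumMaxGenEigenspace Complex.halfPlane, B v w = 0 := fun v hv w hw ↦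
      LinearMap.apply_eq_zero_of_mem_sumMaxGenEigenspace hskew
        (fun _ hμ _ hν ↦ Complex.add_ne_zero_of_mem_halfPlane hμ hν) hv hw
    have hiso' : ∀ v ∈ f.sumMaxGenEigenspace {μ | -μ ∈ Complex.halfPlane},
        ∀ w ∈ f.sumMaxGenEigenspace {μ | -μ ∈ Complex.halfPlane}, B v w = 0 := fun v hv w hw ↦ by
      refine LinearMap.apply_eq_zero_of_mem_sumMaxGenEigenspace hskew
        (s := {μ | -μ ∈ Complex.halfPlane}) (fun μ hμ ν hν h ↦
          Complex.add_ne_zero_of_mem_halfPlane (z := -μ) (w := -ν) hμ hν ?_) hv hw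
      linear_combination - h
    have htop : f.sumMaxGenEigenspace Complex.halfPlane ⊔
        f.sumMaxGenEigenspace {μ | -μ ∈ Complex.halfPlane} = ⊤ :=
      LinearMap.sumMaxGenEigenspace_sup_eq_top hinj fun _ ↦ Complex.mem_halfPlane_or_neg_mem
    have hdisj : Disjoint (f.sumMaxGenEigenspace Complex.halfPlane)
        (f.sumMaxGenEigenspace {μ | -μ ∈ Complex.halfPlane}) := by
      rw [Submodule.disjoint_def]
      intro v hv hv'
      refine hB.1 v fun u ↦ ?_
      obtain ⟨a, ha, b, hb, rfl⟩ := Submodule.mem_sup.mp (htop ▸ Submodule.mem_top (x := u))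
      rw [map_add, hiso v hv a ha, hiso' v hv' b hb, add_zero]
    exact ⟨_, exists_equiv_prod_dual_of_isCompl hB hBinv
      ⟨hdisj, codisjoint_iff.mpr htop⟩ hiso hiso'⟩
  · rintro ⟨W, e, he⟩
    constructor
    · simpa using exists_invariant_form_of_equiv_prod_dual hcc e he (c := 1) (by norm_num)
    · simpa using exists_invariant_form_of_equiv_prod_dual hcc e he (c := -1) (by norm_num)
end

section
/- With K'_i and K_i as defined: 1 ∈ K_0; K_i ⊆ K_{i+1} for every i ≥ 0; and K_i · K_j ⊆ K_{i+j} for all i, j ≥ 0, where the product is taken in H. In particular, (K_i)_{i≥0} is an algebra filtration of H. -/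
open TensorProduct

section HopfHecke

variable (F H V : Type*) [Field F] [CharZero F] [Ring H] [HopfAlgebra F H]
  [AddCommGroup V] [Module F V] [Module H V] [IsScalarTower F H V]

/-- The "triangle" operation `h ▷ v := h • v − ε(h) • v`, as a bilinear map. -/
noncomputable def trb : H →ₗ[F] V →ₗ[F] V :=
  LinearMap.mk₂ F (fun h v => h • v - Coalgebra.counit (R := F) h • v)
    (fun h h' v => by simp [add_smul, map_add]; abel)
    (fun c h v => by simp [smul_assoc, smul_sub, smul_smul])
    (fun h v v' => by simp [smul_add]; abel)
    (fun c h v => by simp [smul_comm c, smul_sub])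

/-- The Sweedler-style element
`(h₍₁₎ ▷ v₁) ∧ ⋯ ∧ (h₍k₎ ▷ v_k) ⊗ h₍k₊₁₎ ∈ ΛV ⊗ H`, as a linear map in `h`. -/
noncomputable def sweedlerWedge : (k : ℕ) → (Fin k → V) →
    (H →ₗ[F] ExteriorAlgebra F V ⊗[F] H)
  | 0, _ => TensorProduct.mk F (ExteriorAlgebra F V) H 1
  | (k+1), vs =>
      TensorProduct.lift
        (((LinearMap.llcomp F H (ExteriorAlgebra F V ⊗[F] H) (ExteriorAlgebra F V ⊗[F] H)).flip
            (sweedlerWedge k (fun i => vs i.succ))) ∘ₗ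
          (LinearMap.rTensorHom (M := H)) ∘ₗ (LinearMap.mul F (ExteriorAlgebra F V)) ∘ₗ
          (ExteriorAlgebra.ι F) ∘ₗ ((trb F H V).flip (vs 0))) ∘ₗ
        (Coalgebra.comul (R := F))

/-- Applying the counit to the trailing tensor factor; composing this with
`sweedlerWedge (i+1) vs` gives `(h₍₁₎ ▷ v₁) ∧ ⋯ ∧ (h₍ᵢ₊₁₎ ▷ v_{i+1}) ∈ ΛV`. -/
noncomputable def purify : ExteriorAlgebra F V ⊗[F] H →ₗ[F] ExteriorAlgebra F V :=
  (TensorProduct.rid F (ExteriorAlgebra F V)).toLinearMap ∘ₗ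
    (LinearMap.lTensor (ExteriorAlgebra F V) (Coalgebra.counit (R := F)))

/-- The subspace `K'_i ⊆ H` of elements `h` with
`(h₍₁₎ ▷ v₁) ∧ ⋯ ∧ (h₍ᵢ₊₁₎ ▷ v_{i+1}) = 0` for all `v₁, …, v_{i+1} ∈ V`. -/
noncomputable def Kp (i : ℕ) : Submodule F H :=
  ⨅ vs : Fin (i+1) → V,
    LinearMap.ker ((purify F H V) ∘ₗ (sweedlerWedge F H V (i+1) vs))

/-- The subspace `K_i := Δ⁻¹(K'_i ⊗ H) ⊆ H`. -/
noncomputable def K (i : ℕ) : Submodule F H :=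
  Submodule.comap (Coalgebra.comul (R := F))
    (LinearMap.range (TensorProduct.map (Kp F H V i).subtype (LinearMap.id (M := H))))

end HopfHecke

section Coaction

variable {F H Y : Type*} [Field F] [Ring H] [HopfAlgebra F H] [AddCommGroup Y] [Module F Y]

/-- The operator `y ⊗ b ↦ f b₍₁₎ y ⊗ b₍₂₎` on `Y ⊗ H` attached to `f : H → End Y`. -/
noncomputable def coact : (H →ₗ[F] Module.End F Y) →ₗ[F] Module.End F (Y ⊗[F] H) where
  toFun f := TensorProduct.lift
    ((LinearMap.lcomp F (Y ⊗[F] H) (Coalgebra.comul (R := F))) ∘ₗ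
      (LinearMap.rTensorHom (M := H)) ∘ₗ f.flip)
  map_add' f g := by
    ext y b
    have h : (f + g).flip y = f.flip y + g.flip y := by ext; simp
    simp [h, LinearMap.rTensor_add]
  map_smul' c f := by
    ext y b
    have h : (c • f).flip y = c • f.flip y := by ext; simp
    simp [h, LinearMap.rTensor_smul]

theorem coact_tmul (f : H →ₗ[F] Module.End F Y) (y : Y) (b : H) :
    coact f (y ⊗ₜ[F] b) = (f.flip y).rTensor H (Coalgebra.comul b) := by
  simp [coact]

theorem coact_tmul_repr (f : H →ₗ[F] Module.End F Y) {ι : Type*} (y : Y) (b : H)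
    (r : Coalgebra.Repr F b ι) :
    coact f (y ⊗ₜ[F] b) = ∑ i ∈ r.index, f (r.left i) y ⊗ₜ[F] r.right i := by
  simp [coact_tmul, ← r.eq]

/-- Composition of two operators `coact f` and `coact g` is again of this form. -/
theorem coact_mul (f g : H →ₗ[F] Module.End F Y) :
    coact f * coact g = coact (LinearMap.mul' F (Module.End F Y) ∘ₗ TensorProduct.map f g ∘ₗ
      (TensorProduct.comm F H H).toLinearMap ∘ₗ Coalgebra.comul) := by
  ext y b
  have key : ∀ t : H ⊗[F] H, coact f ((g.flip y).rTensor H t) =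
      ((LinearMap.mul' F (Module.End F Y) ∘ₗ TensorProduct.map f g ∘ₗ
        (TensorProduct.comm F H H).toLinearMap).flip y).rTensor H
        ((TensorProduct.assoc F H H H).symm (Coalgebra.comul.lTensor H t)) := by
    intro t
    induction t with
    | zero => simp
    | add s t hs ht => simp only [map_add, hs, ht]
    | tmul p q =>
      let r := Coalgebra.Repr.arbitrary F q
      simp [coact_tmul_repr f _ q r, ← r.eq, tmul_sum]
  simp only [AlgebraTensorModule.curry_apply, LinearMap.restrictScalars_self, curry_apply,
    Module.End.mul_apply]
  rw [coact_tmul, key, Coalgebra.coassoc_symm_apply, coact_tmul, ← LinearMap.comp_apply,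
    ← LinearMap.rTensor_comp]
  rfl

theorem coact_mul_eq_neg
    (hcc : ∀ h : H, (TensorProduct.comm F H H) (Coalgebra.comul h) = Coalgebra.comul h)
    (f g : H →ₗ[F] Module.End F Y) (hfg : ∀ b c, f b * g c = -(g c * f b)) :
    coact f * coact g = -(coact g * coact f) := by
  have h : LinearMap.mul' F (Module.End F Y) ∘ₗ TensorProduct.map g f ∘ₗ
      (TensorProduct.comm F H H).toLinearMap =
      -(LinearMap.mul' F (Module.End F Y) ∘ₗ TensorProduct.map f g) := by
    ext b c : 3
    simp [hfg]
  have h2 : (TensorProduct.comm F H H).toLinearMap ∘ₗ Coalgebra.comul =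
      Coalgebra.comul (R := F) (A := H) := LinearMap.ext hcc
  have h3 := congrArg (fun φ => φ ∘ₗ Coalgebra.comul (R := F) (A := H)) h
  simp only [LinearMap.comp_assoc, h2, LinearMap.neg_comp] at h3
  rw [coact_mul, coact_mul, h2, h3, map_neg, neg_neg]

end Coaction

section Words

variable {F M V : Type*} [CommRing F] [AddCommGroup M] [Module F M]

/-- Apply the operators `A v`, for `v` running through a list, to `m`, first letter first. -/
def applyWord (A : V → Module.End F M) : List V → Module.End F M
  | [] => 1
  | v :: l => applyWord A l * A v

theorem applyWord_append (A : V → Module.End F M) (l l' : List V) :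
    applyWord A (l ++ l') = applyWord A l' * applyWord A l := by
  induction l with
  | nil => simp [applyWord]
  | cons v l ih => simp [applyWord, ih, mul_assoc]

theorem applyWord_apply_eq_zero_of_anticomm {A : V → Module.End F M} {C : Module.End F M}
    (h : ∀ v, A v * C = -(C * A v)) (l : List V) {m : M} (hm : applyWord A l m = 0) :
    applyWord A l (C m) = 0 := by
  have key : ∀ (l : List V) (m : M), applyWord A l (C m) = C (applyWord A l m) ∨
      applyWord A l (C m) = -C (applyWord A l m) := by
    intro l
    induction l with
    | nil => intro m; exact Or.inl rfl
    | cons v l ih =>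
      intro m
      have h1 : A v (C m) = -C (A v m) := LinearMap.congr_fun (h v) m
      simp only [applyWord, Module.End.mul_apply, h1, map_neg]
      rcases ih (A v m) with h2 | h2 <;> simp [h2]
  rcases key l m with h2 | h2 <;> simp [h2, hm]

theorem applyWord_add_apply_eq_zero {A B : V → Module.End F M}
    (hAB : ∀ u v, A u * B v = -(B v * A u)) (l : List V) :
    ∀ (i j : ℕ) (m : M), i + j ≤ l.length + 1 →
      (∀ w : List V, w.length = i → applyWord A w m = 0) →
      (∀ w : List V, w.length = j → applyWord B w m = 0) →
      applyWord (fun v => A v + B v) l m = 0 := by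
  induction l with
  | nil =>
    intro i j m hij hA hB
    obtain rfl | rfl : i = 0 ∨ j = 0 := by simp at hij; omega
    · exact hA [] rfl
    · exact hB [] rfl
  | cons v l ih =>
    intro i j m hij hA hB
    simp only [List.length_cons] at hij
    rcases i with _ | i
    · rw [show m = 0 from hA [] rfl, map_zero]
    rcases j with _ | j
    · rw [show m = 0 from hB [] rfl, map_zero]
    have hBA : ∀ u v, B u * A v = -(A v * B u) := fun u v => by rw [hAB, neg_neg]
    simp only [applyWord, Module.End.mul_apply, LinearMap.add_apply, map_add]
    rw [ih i (j + 1) (A v m) (by omega) (fun w hw => hA (v :: w) (by simp [hw]))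
        (fun w hw => applyWord_apply_eq_zero_of_anticomm (fun u => hBA u v) w (hB w hw)),
      ih (i + 1) j (B v m) (by omega)
        (fun w hw => applyWord_apply_eq_zero_of_anticomm (fun u => hAB u v) w (hA w hw))
        (fun w hw => hB (v :: w) (by simp [hw])), add_zero]

end Words

section WedgeRight

variable {F V : Type*} [Field F] [AddCommGroup V] [Module F V]

variable (F V) in
/-- Right multiplication by `v` on the exterior algebra, linearly in `v`. -/
noncomputable def wedgeRight : V →ₗ[F] Module.End F (ExteriorAlgebra F V) :=
  (LinearMap.mul F (ExteriorAlgebra F V)).flip ∘ₗ ExteriorAlgebra.ι F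

theorem wedgeRight_apply (v : V) (x : ExteriorAlgebra F V) :
    wedgeRight F V v x = x * ExteriorAlgebra.ι F v := rfl

theorem wedgeRight_anticomm (u v : V) :
    wedgeRight F V u * wedgeRight F V v = -(wedgeRight F V v * wedgeRight F V u) := by
  ext x
  have h : ExteriorAlgebra.ι F u * ExteriorAlgebra.ι F v =
      -(ExteriorAlgebra.ι F v * ExteriorAlgebra.ι F u) :=
    eq_neg_of_add_eq_zero_left (ExteriorAlgebra.ι_add_mul_swap u v)
  simp [wedgeRight_apply, mul_assoc, h]

end WedgeRight

section HopfHecke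

variable {F H V : Type*} [Field F] [Ring H] [HopfAlgebra F H]
  [AddCommGroup V] [Module F V] [Module H V] [IsScalarTower F H V]

variable (F H V) in
/-- The operator `x ⊗ h ↦ x ∧ (h₍₁₎ ▷ v) ⊗ h₍₂₎`. -/
noncomputable def wedgeTrb : V →ₗ[F] Module.End F (ExteriorAlgebra F V ⊗[F] H) :=
  coact ∘ₗ (LinearMap.llcomp F H V (Module.End F (ExteriorAlgebra F V)) (wedgeRight F V)) ∘ₗ
    (trb F H V).flip

theorem wedgeTrb_apply (v : V) :
    wedgeTrb F H V v = coact (wedgeRight F V ∘ₗ (trb F H V).flip v) := rfl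

theorem sweedlerWedge_succ_apply (k : ℕ) (vs : Fin (k + 1) → V) {ι : Type*} (h : H)
    (r : Coalgebra.Repr F h ι) :
    sweedlerWedge F H V (k + 1) vs h = ∑ i ∈ r.index,
      (LinearMap.mulLeft F (ExteriorAlgebra.ι F (trb F H V (r.left i) (vs 0)))).rTensor H
        (sweedlerWedge F H V k (fun i => vs i.succ) (r.right i)) := by
  simp only [sweedlerWedge, LinearMap.comp_apply, ← r.eq, map_sum]
  rfl

theorem applyWord_wedgeTrb (k : ℕ) (vs : Fin k → V) (x : ExteriorAlgebra F V) (h : H) :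
    applyWord (wedgeTrb F H V) (List.ofFn vs) (x ⊗ₜ[F] h) =
      (LinearMap.mulLeft F x).rTensor H (sweedlerWedge F H V k vs h) := by
  induction k generalizing x h with
  | zero => simp [applyWord, sweedlerWedge]
  | succ k ih =>
    let r := Coalgebra.Repr.arbitrary F h
    rw [sweedlerWedge_succ_apply k vs h r, List.ofFn_succ]
    simp only [applyWord, Module.End.mul_apply, wedgeTrb_apply, coact_tmul_repr _ _ _ r, map_sum]
    refine Finset.sum_congr rfl fun i _ => ?_
    rw [ih, ← LinearMap.rTensor_comp_apply, ← LinearMap.mulLeft_mul]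
    rfl

theorem applyWord_wedgeTrb_one (k : ℕ) (vs : Fin k → V) (h : H) :
    applyWord (wedgeTrb F H V) (List.ofFn vs) (1 ⊗ₜ[F] h) = sweedlerWedge F H V k vs h := by
  simp [applyWord_wedgeTrb]

/-- `sweedlerWedge` is a map of right `H`-comodules. -/
theorem lTensor_comul_sweedlerWedge (k : ℕ) (vs : Fin k → V) :
    (Coalgebra.comul (R := F)).lTensor (ExteriorAlgebra F V) ∘ₗ sweedlerWedge F H V k vs =
      (TensorProduct.assoc F _ _ _).toLinearMap ∘ₗ
        (sweedlerWedge F H V k vs).rTensor H ∘ₗ Coalgebra.comul := by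
  induction k with
  | zero =>
    ext h
    let r := Coalgebra.Repr.arbitrary F h
    simp [sweedlerWedge, ← r.eq]
  | succ k ih =>
    set S := sweedlerWedge F H V k (fun i => vs i.succ) with hS
    let Φ : H ⊗[F] H →ₗ[F] ExteriorAlgebra F V ⊗[F] H := TensorProduct.lift
      (((LinearMap.llcomp F H (ExteriorAlgebra F V ⊗[F] H) (ExteriorAlgebra F V ⊗[F] H)).flip S) ∘ₗ
          (LinearMap.rTensorHom (M := H)) ∘ₗ (LinearMap.mul F (ExteriorAlgebra F V)) ∘ₗ
          (ExteriorAlgebra.ι F) ∘ₗ ((trb F H V).flip (vs 0)))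
    have hΦ : ∀ p q, Φ (p ⊗ₜ q) =
        (LinearMap.mulLeft F (ExteriorAlgebra.ι F (trb F H V p (vs 0)))).rTensor H (S q) :=
      fun p q => rfl
    have hs : sweedlerWedge F H V (k + 1) vs = Φ ∘ₗ Coalgebra.comul := rfl
    have nat : ∀ (g : Module.End F (ExteriorAlgebra F V)) (t : (ExteriorAlgebra F V) ⊗[F] H),
        (Coalgebra.comul (R := F)).lTensor _ (g.rTensor H t) =
          g.rTensor (H ⊗[F] H) ((Coalgebra.comul (R := F)).lTensor _ t) := by
      intro g t
      rw [← LinearMap.comp_apply, ← LinearMap.comp_apply, LinearMap.lTensor_comp_rTensor,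
        LinearMap.rTensor_comp_lTensor]
    have nat2 : ∀ (g : Module.End F (ExteriorAlgebra F V))
        (t : ((ExteriorAlgebra F V) ⊗[F] H) ⊗[F] H),
        g.rTensor (H ⊗[F] H) (TensorProduct.assoc F _ _ _ t) =
          TensorProduct.assoc F _ _ _ ((g.rTensor H).rTensor H t) := by
      intro g t
      rw [LinearMap.rTensor_tensor]
      simp
    have key : ∀ t : H ⊗[F] H, (Coalgebra.comul (R := F)).lTensor (ExteriorAlgebra F V) (Φ t) =
        TensorProduct.assoc F _ _ _ (Φ.rTensor H
          ((TensorProduct.assoc F H H H).symm (Coalgebra.comul.lTensor H t))) := by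
      intro t
      induction t with
      | zero => simp
      | add s t hs ht => simp only [map_add, hs, ht]
      | tmul p q =>
        have h1 := LinearMap.congr_fun (ih (fun i => vs i.succ)) q
        simp only [LinearMap.comp_apply, LinearEquiv.coe_coe] at h1
        rw [hΦ, nat, h1, nat2]
        let r := Coalgebra.Repr.arbitrary F q
        simp [← r.eq, tmul_sum, hΦ, hS]
    ext h
    simp only [hs, LinearMap.comp_apply, LinearEquiv.coe_coe, key, Coalgebra.coassoc_symm_apply,
      LinearMap.rTensor_comp]

theorem rTensor_purify_comul (k : ℕ) (vs : Fin k → V) (h : H) :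
    (purify F H V ∘ₗ sweedlerWedge F H V k vs).rTensor H (Coalgebra.comul h) =
      sweedlerWedge F H V k vs h := by
  have h1 := LinearMap.congr_fun (lTensor_comul_sweedlerWedge (F := F) (H := H) k vs) h
  simp only [LinearMap.comp_apply, LinearEquiv.coe_coe] at h1
  have h2 : ∀ t : (ExteriorAlgebra F V ⊗[F] H) ⊗[F] H, (purify F H V).rTensor H t =
      (TensorProduct.lid F H).toLinearMap.lTensor _
        (((Coalgebra.counit (R := F) (A := H)).rTensor H).lTensor _
          (TensorProduct.assoc F _ _ _ t)) := by
    intro t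
    refine LinearMap.congr_fun (f := (purify F H V).rTensor H)
      (g := (TensorProduct.lid F H).toLinearMap.lTensor _ ∘ₗ
        ((Coalgebra.counit (R := F) (A := H)).rTensor H).lTensor _ ∘ₗ
          (TensorProduct.assoc F _ _ _).toLinearMap) ?_ t
    ext x a b
    simp [purify, smul_tmul]
  rw [LinearMap.rTensor_comp, LinearMap.comp_apply, h2, ← h1, ← LinearMap.comp_apply,
    ← LinearMap.comp_apply, ← LinearMap.lTensor_comp, ← LinearMap.lTensor_comp,
    LinearMap.comp_assoc, Coalgebra.rTensor_counit_comp_comul]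
  have h3 : (TensorProduct.lid F H).toLinearMap ∘ₗ TensorProduct.mk F F H 1 = LinearMap.id := by
    ext; simp
  rw [h3, LinearMap.lTensor_id, LinearMap.id_apply]

theorem mem_K_iff_sweedlerWedge (i : ℕ) (h : H) :
    h ∈ K F H V i ↔ ∀ vs : Fin (i + 1) → V, sweedlerWedge F H V (i + 1) vs h = 0 := by
  constructor
  · rintro ⟨t, ht⟩ vs
    rw [← rTensor_purify_comul, ← ht, LinearMap.rTensor, ← LinearMap.comp_apply,
      ← TensorProduct.map_comp]
    have h0 : (purify F H V ∘ₗ sweedlerWedge F H V (i + 1) vs) ∘ₗ (Kp F H V i).subtype = 0 := by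
      ext x
      exact (Submodule.mem_iInf _).1 x.2 vs
    simp [h0]
  · intro hv
    let 𝓑 := Module.Basis.ofVectorSpace F H
    obtain ⟨c, hc⟩ := TensorProduct.eq_repr_basis_right 𝓑 (Coalgebra.comul (R := F) h)
    have hmem : ∀ b, c b ∈ Kp F H V i := by
      intro b
      refine (Submodule.mem_iInf _).2 fun vs => ?_
      have h0 := hv vs
      rw [← rTensor_purify_comul, ← hc, Finsupp.sum, map_sum] at h0
      simp only [LinearMap.rTensor_tmul] at h0
      have := TensorProduct.sum_tmul_basis_right_eq_zero 𝓑
        (c.mapRange (purify F H V ∘ₗ sweedlerWedge F H V (i + 1) vs) (map_zero _))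
        (by
          rw [Finsupp.sum_mapRange_index (by simp)]
          exact h0)
      simpa using DFunLike.congr_fun this b
    change Coalgebra.comul h ∈ LinearMap.range _
    rw [← hc]
    exact Submodule.sum_mem _ fun b _ => ⟨(⟨c b, hmem b⟩ : Kp F H V i) ⊗ₜ 𝓑 b, by simp⟩

theorem mem_K_iff (i : ℕ) (h : H) :
    h ∈ K F H V i ↔ ∀ l : List V, l.length = i + 1 →
      applyWord (wedgeTrb F H V) l (1 ⊗ₜ[F] h) = 0 := by
  rw [mem_K_iff_sweedlerWedge]
  constructor
  · intro hv l hl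
    obtain ⟨vs, rfl⟩ : ∃ vs : Fin (i + 1) → V, List.ofFn vs = l := by
      exact ⟨fun j => l.get (j.cast hl.symm), by
        rw [← List.ofFn_congr hl]
        exact List.ofFn_get l⟩
    rw [applyWord_wedgeTrb_one, hv]
  · intro hv vs
    rw [← applyWord_wedgeTrb_one, hv _ (List.length_ofFn)]

variable (F H V) in
/-- The operator `x ⊗ a ⊗ b ↦ x ∧ (a₍₁₎ ▷ b₍₁₎ v) ⊗ a₍₂₎ ⊗ b₍₂₎`. -/
noncomputable def wedgeTrbLeft (v : V) :
    Module.End F ((ExteriorAlgebra F V ⊗[F] H) ⊗[F] H) :=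
  coact (wedgeTrb F H V ∘ₗ (LinearMap.toSpanSingleton H V v).restrictScalars F)

variable (F H V) in
/-- The operator `x ⊗ a ⊗ b ↦ x ∧ (b₍₁₎ ▷ v) ⊗ a ⊗ b₍₂₎`. -/
noncomputable def wedgeTrbRight (v : V) :
    Module.End F ((ExteriorAlgebra F V ⊗[F] H) ⊗[F] H) :=
  coact (LinearMap.rTensorHom H ∘ₗ wedgeRight F V ∘ₗ (trb F H V).flip v)

theorem wedgeTrb_anticomm_rTensor (u v : V) :
    wedgeTrb F H V u * (wedgeRight F V v).rTensor H =
      -((wedgeRight F V v).rTensor H * wedgeTrb F H V u) := by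
  refine TensorProduct.ext' fun x a => ?_
  let r := Coalgebra.Repr.arbitrary F a
  have h : ∀ w, wedgeRight F V w (wedgeRight F V v x) = -wedgeRight F V v (wedgeRight F V w x) :=
    fun w => LinearMap.congr_fun (wedgeRight_anticomm w v) x
  simp [wedgeTrb_apply, coact_tmul_repr _ _ _ r, h, neg_tmul]

theorem wedgeTrbLeft_anticomm
    (hcc : ∀ h : H, (TensorProduct.comm F H H) (Coalgebra.comul h) = Coalgebra.comul h)
    (u v : V) :
    wedgeTrbLeft F H V u * wedgeTrbRight F H V v =
      -(wedgeTrbRight F H V v * wedgeTrbLeft F H V u) :=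
  coact_mul_eq_neg hcc _ _ fun _ _ => wedgeTrb_anticomm_rTensor _ _

variable (F H V) in
/-- Multiplication of the two trailing tensor factors. -/
noncomputable def mulTail : (ExteriorAlgebra F V ⊗[F] H) ⊗[F] H →ₗ[F] ExteriorAlgebra F V ⊗[F] H :=
  (LinearMap.mul' F H).lTensor _ ∘ₗ (TensorProduct.assoc F _ _ _).toLinearMap

theorem trb_mul (a b : H) (v : V) :
    trb F H V (a * b) v = trb F H V a (b • v) + Coalgebra.counit (R := F) a • trb F H V b v := by
  simp [trb, mul_smul, smul_sub]

theorem wedgeTrb_mulTail (v : V) :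
    wedgeTrb F H V v ∘ₗ mulTail F H V =
      mulTail F H V ∘ₗ (wedgeTrbLeft F H V v + wedgeTrbRight F H V v) := by
  ext x a b
  let r := Coalgebra.Repr.arbitrary F a
  let s := Coalgebra.Repr.arbitrary F b
  have hab : Coalgebra.comul (R := F) (a * b) = ∑ j ∈ s.index, ∑ i ∈ r.index,
      (r.left i * s.left j) ⊗ₜ[F] (r.right i * s.right j) := by
    rw [Bialgebra.comul_mul, ← r.eq, ← s.eq, Finset.sum_mul_sum, Finset.sum_comm]
    simp
  have ha : ∑ i ∈ r.index, Coalgebra.counit (R := F) (r.left i) • r.right i = a :=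
    Coalgebra.sum_counit_smul r
  have h1 : wedgeTrb F H V v (x ⊗ₜ (a * b)) = ∑ j ∈ s.index, ∑ i ∈ r.index,
      wedgeRight F V (trb F H V (r.left i * s.left j) v) x ⊗ₜ[F] (r.right i * s.right j) := by
    simp [wedgeTrb_apply, coact_tmul, hab]
  have h2 : mulTail F H V (wedgeTrbLeft F H V v ((x ⊗ₜ a) ⊗ₜ b)) =
      ∑ j ∈ s.index, ∑ i ∈ r.index,
        wedgeRight F V (trb F H V (r.left i) (s.left j • v)) x ⊗ₜ[F]
          (r.right i * s.right j) := by
    simp [wedgeTrbLeft, mulTail, wedgeTrb_apply, coact_tmul_repr _ _ _ r, coact_tmul_repr _ _ _ s,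
      sum_tmul]
  have h3 : mulTail F H V (wedgeTrbRight F H V v ((x ⊗ₜ a) ⊗ₜ b)) =
      ∑ j ∈ s.index, wedgeRight F V (trb F H V (s.left j) v) x ⊗ₜ[F] (a * s.right j) := by
    simp [wedgeTrbRight, mulTail, coact_tmul_repr _ _ _ s]
  have h4 : mulTail F H V ((x ⊗ₜ a) ⊗ₜ b) = x ⊗ₜ (a * b) := by simp [mulTail]
  simp only [AlgebraTensorModule.curry_apply, LinearMap.restrictScalars_self, curry_apply,
    LinearMap.comp_apply, LinearMap.add_apply, map_add]
  rw [h4, h1, h2, h3, ← Finset.sum_add_distrib]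
  refine Finset.sum_congr rfl fun j _ => ?_
  have h5 : a * s.right j =
      ∑ i ∈ r.index, (Coalgebra.counit (R := F) (r.left i) • r.right i) * s.right j := by
    rw [← Finset.sum_mul, ha]
  rw [h5]
  simp only [trb_mul, map_add, map_smul, LinearMap.add_apply, LinearMap.smul_apply, add_tmul,
    Finset.sum_add_distrib, tmul_sum, smul_mul_assoc, tmul_smul, smul_tmul']

theorem applyWord_wedgeTrb_mulTail (l : List V) (t : (ExteriorAlgebra F V ⊗[F] H) ⊗[F] H) :
    applyWord (wedgeTrb F H V) l (mulTail F H V t) =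
      mulTail F H V
        (applyWord (fun v => wedgeTrbLeft F H V v + wedgeTrbRight F H V v) l t) := by
  induction l generalizing t with
  | nil => rfl
  | cons v l ih =>
    have h := LinearMap.congr_fun (wedgeTrb_mulTail (F := F) (H := H) v) t
    simp only [LinearMap.comp_apply] at h
    simp only [applyWord, Module.End.mul_apply, h, ih]

theorem applyWord_wedgeTrbLeft_mem_span (y : ExteriorAlgebra F V ⊗[F] H) (b : H) (l : List V) :
    applyWord (wedgeTrbLeft F H V) l (y ⊗ₜ b) ∈ Submodule.span F
      {t | ∃ (l' : List V) (c : H), l'.length = l.length ∧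
        t = applyWord (wedgeTrb F H V) l' y ⊗ₜ[F] c} := by
  induction l generalizing y b with
  | nil => exact Submodule.subset_span ⟨[], b, rfl, rfl⟩
  | cons v l ih =>
    let r := Coalgebra.Repr.arbitrary F b
    simp only [applyWord, Module.End.mul_apply, wedgeTrbLeft, coact_tmul_repr _ _ _ r, map_sum]
    refine Submodule.sum_mem _ fun i _ => Submodule.span_mono ?_ (ih _ _)
    rintro _ ⟨l', c, hl, rfl⟩
    exact ⟨r.left i • v :: l', c, by simp [hl], rfl⟩

theorem applyWord_wedgeTrbLeft_eq_zero {i : ℕ} {a : H} (ha : a ∈ K F H V i) (b : H)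
    (l : List V) (hl : l.length = i + 1) :
    applyWord (wedgeTrbLeft F H V) l ((1 ⊗ₜ a) ⊗ₜ b) = 0 := by
  refine (Submodule.mem_bot F).1 (Submodule.span_le.2 ?_ (applyWord_wedgeTrbLeft_mem_span _ b l))
  rintro _ ⟨l', c, hl', rfl⟩
  simp [(mem_K_iff i a).1 ha l' (hl'.trans hl)]

variable (F V) in
/-- Insertion of `a` in the middle tensor factor. -/
noncomputable def insertMiddle (a : H) :
    ExteriorAlgebra F V ⊗[F] H →ₗ[F] (ExteriorAlgebra F V ⊗[F] H) ⊗[F] H :=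
  ((TensorProduct.mk F (ExteriorAlgebra F V) H).flip a).rTensor H

theorem applyWord_wedgeTrbRight_insertMiddle (a : H) (l : List V) (t : ExteriorAlgebra F V ⊗[F] H) :
    applyWord (wedgeTrbRight F H V) l (insertMiddle F V a t) =
      insertMiddle F V a (applyWord (wedgeTrb F H V) l t) := by
  have key : ∀ v, wedgeTrbRight F H V v ∘ₗ insertMiddle F V a =
      insertMiddle F V a ∘ₗ wedgeTrb F H V v := by
    intro v
    ext x b
    let r := Coalgebra.Repr.arbitrary F b
    simp [wedgeTrbRight, insertMiddle, wedgeTrb_apply, coact_tmul_repr _ _ _ r]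
  induction l generalizing t with
  | nil => rfl
  | cons v l ih =>
    have h := LinearMap.congr_fun (key v) t
    simp only [LinearMap.comp_apply] at h
    simp only [applyWord, Module.End.mul_apply, h, ih]

theorem one_mem_K_zero : (1 : H) ∈ K F H V 0 := by
  rw [mem_K_iff]
  intro l hl
  obtain ⟨v, rfl⟩ := List.length_eq_one_iff.1 hl
  simp [applyWord, wedgeTrb_apply, coact_tmul, Algebra.TensorProduct.one_def, trb]

theorem K_le_succ (i : ℕ) : K F H V i ≤ K F H V (i + 1) := by
  intro h hh
  rw [mem_K_iff] at hh ⊢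
  intro l hl
  obtain rfl | ⟨l, v, rfl⟩ := l.eq_nil_or_concat
  · simp at hl
  · rw [List.concat_eq_append, applyWord_append, Module.End.mul_apply,
      hh l (by simpa using hl), map_zero]

theorem mul_mem_K
    (hcc : ∀ h : H, (TensorProduct.comm F H H) (Coalgebra.comul h) = Coalgebra.comul h)
    {i j : ℕ} {a b : H} (ha : a ∈ K F H V i) (hb : b ∈ K F H V j) :
    a * b ∈ K F H V (i + j) := by
  rw [mem_K_iff]
  intro l hl
  have h1 : (1 : ExteriorAlgebra F V) ⊗ₜ[F] (a * b) = mulTail F H V ((1 ⊗ₜ a) ⊗ₜ b) := by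
    simp [mulTail]
  rw [h1, applyWord_wedgeTrb_mulTail,
    applyWord_add_apply_eq_zero (wedgeTrbLeft_anticomm hcc) l (i + 1) (j + 1) _ (by omega)
      (applyWord_wedgeTrbLeft_eq_zero ha b), map_zero]
  intro w hw
  have h2 : ((1 : ExteriorAlgebra F V) ⊗ₜ[F] a) ⊗ₜ[F] b = insertMiddle F V a (1 ⊗ₜ b) := rfl
  rw [h2, applyWord_wedgeTrbRight_insertMiddle, (mem_K_iff j b).1 hb w hw, map_zero]

end HopfHecke

/-- `1 ∈ K_0`, `K_i ⊆ K_{i+1}` for all `i ≥ 0`, and `K_i · K_j ⊆ K_{i+j}`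
for all `i, j ≥ 0`; in particular `(K_i)_{i≥0}` is an algebra filtration of `H`. -/
theorem stmt_2 (F H V : Type*) [Field F] [CharZero F] [Ring H] [HopfAlgebra F H]
    -- cocommutativity of `H`
    (hcc : ∀ h : H, (TensorProduct.comm F H H) (Coalgebra.comul h) = Coalgebra.comul h)
    [AddCommGroup V] [Module F V] [Module H V] [IsScalarTower F H V]
    [Module.Finite F V] :
    (1 : H) ∈ K F H V 0 ∧
    (∀ i : ℕ, K F H V i ≤ K F H V (i + 1)) ∧
    (∀ (i j : ℕ) (a b : H), a ∈ K F H V i → b ∈ K F H V j → a * b ∈ K F H V (i + j)) := by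
  exact ⟨one_mem_K_zero, K_le_succ, fun _ _ _ _ => mul_mem_K hcc⟩
end

section
/- For every i ≥ 0, K_i is a subcoalgebra of H; that is, Δ(K_i) ⊆ K_i ⊗ K_i. -/
open TensorProduct

namespace Submodule

open Coalgebra

variable {R C : Type*} [Field R] [AddCommGroup C] [Module R C] [Coalgebra R C]

/-- The composite `C → C ⊗ C → (C ⧸ W) ⊗ C`, whose kernel is `Δ⁻¹(W ⊗ C)`. -/
noncomputable def comulMkQ (W : Submodule R C) : C →ₗ[R] (C ⧸ W) ⊗[R] C :=
  W.mkQ.rTensor C ∘ₗ comul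

theorem comap_comul_range_eq_ker (W : Submodule R C) :
    (LinearMap.range (TensorProduct.map W.subtype (LinearMap.id (M := C)))).comap
      (comul (R := R)) = LinearMap.ker (comulMkQ W) := by
  have h : Function.Exact (W.subtype.rTensor C) (W.mkQ.rTensor C) :=
    rTensor_exact C (LinearMap.exact_subtype_mkQ W) W.mkQ_surjective
  ext x
  exact (h (comul x)).symm

theorem rTensor_comulMkQ_comul (W : Submodule R C) {x : C} (hx : comulMkQ W x = 0) :
    (comulMkQ W).rTensor C (comul x) = 0 := by
  have key : ∀ t : C ⊗[R] (C ⊗[R] C),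
      (W.mkQ.rTensor C).rTensor C ((TensorProduct.assoc R C C C).symm t) =
        (TensorProduct.assoc R (C ⧸ W) C C).symm (W.mkQ.rTensor (C ⊗[R] C) t) := by
    intro t
    exact LinearMap.congr_fun (f := (W.mkQ.rTensor C).rTensor C ∘ₗ
      (TensorProduct.assoc R C C C).symm.toLinearMap)
      (g := (TensorProduct.assoc R (C ⧸ W) C C).symm.toLinearMap ∘ₗ
        W.mkQ.rTensor (C ⊗[R] C)) (by ext; rfl) t
  have swap : W.mkQ.rTensor (C ⊗[R] C) ((comul (R := R) (A := C)).lTensor C (comul x)) =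
      (comul (R := R) (A := C)).lTensor (C ⧸ W) (W.mkQ.rTensor C (comul x)) :=
    LinearMap.congr_fun ((LinearMap.rTensor_comp_lTensor _ _ _).trans
      (LinearMap.lTensor_comp_rTensor _ _ _).symm) _
  rw [comulMkQ, LinearMap.rTensor_comp, LinearMap.comp_apply, ← coassoc_symm_apply, key, swap]
  rw [comulMkQ, LinearMap.comp_apply] at hx
  rw [hx, map_zero, map_zero]

/-- Over a field, a tensor annihilated by `f ⊗ id` and by `id ⊗ f` lies in `ker f ⊗ ker f`. -/
theorem _root_.LinearMap.mem_range_map_ker_subtype {M N : Type*} [AddCommGroup M] [Module R M]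
    [AddCommGroup N] [Module R N] (f : M →ₗ[R] N) {t : M ⊗[R] M}
    (h₁ : f.rTensor M t = 0) (h₂ : f.lTensor M t = 0) :
    t ∈ LinearMap.range
      (TensorProduct.map (LinearMap.ker f).subtype (LinearMap.ker f).subtype) := by
  obtain ⟨y, rfl⟩ := (Module.Flat.rTensor_exact M (LinearMap.exact_subtype_ker_map f) t).1 h₁
  have hy : f.lTensor (LinearMap.ker f) y = 0 := by
    apply Module.Flat.rTensor_preserves_injective_linearMap (M := N) (LinearMap.ker f).subtype
      (LinearMap.ker f).injective_subtype
    rw [map_zero, ← h₂, ← LinearMap.comp_apply, ← LinearMap.comp_apply,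
      LinearMap.rTensor_comp_lTensor, LinearMap.lTensor_comp_rTensor]
  obtain ⟨z, rfl⟩ :=
    (Module.Flat.lTensor_exact (LinearMap.ker f) (LinearMap.exact_subtype_ker_map f) y).1 hy
  exact ⟨z, by rw [← LinearMap.comp_apply, LinearMap.rTensor_comp_lTensor]⟩

/-- In a cocommutative coalgebra over a field, `Δ⁻¹(W ⊗ C) = ker (comulMkQ W)` is a subcoalgebra for
every subspace `W`. -/
theorem comul_mem_range_map_ker_comulMkQ
    (hcc : ∀ x : C, TensorProduct.comm R C C (comul x) = comul x) (W : Submodule R C) {x : C}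
    (hx : x ∈ LinearMap.ker (comulMkQ W)) :
    comul (R := R) x ∈ LinearMap.range (TensorProduct.map
      (LinearMap.ker (comulMkQ W)).subtype (LinearMap.ker (comulMkQ W)).subtype) := by
  have h₁ := rTensor_comulMkQ_comul W hx
  refine LinearMap.mem_range_map_ker_subtype _ h₁ ?_
  rw [← hcc x, ← LinearMap.comm_comp_rTensor_comp_comm_eq]
  simp [h₁]

end Submodule

/-- For every `i ≥ 0`, `K_i` is a subcoalgebra of `H`:
`Δ(K_i) ⊆ K_i ⊗ K_i`. -/
theorem stmt_3 (F H V : Type*) [Field F] [CharZero F] [Ring H] [HopfAlgebra F H]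
    -- cocommutativity of `H`
    (hcc : ∀ h : H, (TensorProduct.comm F H H) (Coalgebra.comul h) = Coalgebra.comul h)
    [AddCommGroup V] [Module F V] [Module H V] [IsScalarTower F H V]
    [Module.Finite F V] :
    ∀ (i : ℕ) (h : H), h ∈ K F H V i →
      Coalgebra.comul (R := F) h ∈
        LinearMap.range (TensorProduct.map (K F H V i).subtype (K F H V i).subtype) := by
  intro i h hh
  have hK : K F H V i = LinearMap.ker (Submodule.comulMkQ (Kp F H V i)) :=
    Submodule.comap_comul_range_eq_ker _
  rw [hK] at hh ⊢
  exact Submodule.comul_mem_range_map_ker_comulMkQ hcc _ hh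
end

section
/- If a linear map κ : Λ²V → H has the Jacobi property, then (z,u | x,y) = (x,y | z,u) in Λ²V ⊗ H for all z, u, x, y ∈ V. -/
open TensorProduct

section Jacobi

variable (F H V : Type*) [Field F] [CharZero F] [Ring H] [HopfAlgebra F H]
  [AddCommGroup V] [Module F V] [Module H V] [IsScalarTower F H V]

/-- The Sweedler-style element `(h₍₁₎ ▷ v) ⊗ h₍₂₎ ∈ V ⊗ H`. -/
noncomputable def Jmap (h : H) (v : V) : V ⊗[F] H :=
  TensorProduct.map ((trb F H V).flip v) LinearMap.id (Coalgebra.comul (R := F) h)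

/-- A bilinear alternating map `κ : Λ²V → H` has the Jacobi property if
`(κ(x,y)₍₁₎ ▷ z) ⊗ κ(x,y)₍₂₎ + (κ(y,z)₍₁₎ ▷ x) ⊗ κ(y,z)₍₂₎ + (κ(z,x)₍₁₎ ▷ y) ⊗ κ(z,x)₍₂₎ = 0`
in `V ⊗ H` for all `x, y, z ∈ V`. -/
def HasJacobi (κ : V →ₗ[F] V →ₗ[F] H) : Prop :=
  ∀ x y z : V,
    Jmap F H V (κ x y) z + Jmap F H V (κ y z) x + Jmap F H V (κ z x) y = 0

end Jacobi

section SweedlerWedge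

variable (F H V : Type*) [Field F] [Ring H] [HopfAlgebra F H]
  [AddCommGroup V] [Module F V] [Module H V] [IsScalarTower F H V]

/-- The linear map `V ⊗ H → ΛV ⊗ H`, `v ⊗ h ↦ v ∧ sweedlerWedge k vs h`. -/
noncomputable def wedgeSweedler (k : ℕ) (vs : Fin k → V) :
    V ⊗[F] H →ₗ[F] ExteriorAlgebra F V ⊗[F] H :=
  TensorProduct.lift
    (((LinearMap.llcomp F H (ExteriorAlgebra F V ⊗[F] H) (ExteriorAlgebra F V ⊗[F] H)).flip
        (sweedlerWedge F H V k vs)) ∘ₗ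
      (LinearMap.rTensorHom (M := H)) ∘ₗ (LinearMap.mul F (ExteriorAlgebra F V)) ∘ₗ
      (ExteriorAlgebra.ι F))

variable {F H V}

theorem sweedlerWedge_succ (k : ℕ) (vs : Fin (k + 1) → V) (h : H) :
    sweedlerWedge F H V (k + 1) vs h =
      wedgeSweedler F H V k (fun i => vs i.succ) (Jmap F H V h (vs 0)) := by
  simp only [sweedlerWedge, wedgeSweedler, Jmap, LinearMap.comp_apply]
  induction Coalgebra.comul (R := F) h using TensorProduct.induction_on with
  | zero => simp only [map_zero]
  | tmul a b => rfl
  | add a b ha hb => simp only [map_add, ha, hb]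

variable (F H) in
/-- The linear map `H ⊗ H → ΛV`, `a ⊗ b ↦ (a ▷ v) ∧ (b ▷ w)`. -/
noncomputable def trbWedge (v w : V) : H ⊗[F] H →ₗ[F] ExteriorAlgebra F V :=
  LinearMap.mul' F (ExteriorAlgebra F V) ∘ₗ
    TensorProduct.map (ExteriorAlgebra.ι F ∘ₗ (trb F H V).flip v)
      (ExteriorAlgebra.ι F ∘ₗ (trb F H V).flip w)

theorem trbWedge_comm (v w : V) (t : H ⊗[F] H) :
    trbWedge F H v w (TensorProduct.comm F H H t) = -trbWedge F H w v t := by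
  induction t using TensorProduct.induction_on with
  | zero => simp only [map_zero, neg_zero]
  | tmul a b =>
    simpa [trbWedge] using eq_neg_of_add_eq_zero_left
      (ExteriorAlgebra.ι_add_mul_swap (R := F) (trb F H V b v) (trb F H V a w))
  | add a b ha hb => simp only [map_add, ha, hb, neg_add]

theorem sweedlerWedge_two (v w : V) (h : H) :
    sweedlerWedge F H V 2 ![v, w] h =
      LinearMap.rTensor H (trbWedge F H v w ∘ₗ Coalgebra.comul) (Coalgebra.comul h) := by
  have key : ∀ t : H ⊗[F] H,
      wedgeSweedler F H V 1 ![w] (TensorProduct.map ((trb F H V).flip v) LinearMap.id t) =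
        LinearMap.rTensor H (trbWedge F H v w) ((TensorProduct.assoc F H H H).symm
          (LinearMap.lTensor H Coalgebra.comul t)) := by
    intro t
    induction t using TensorProduct.induction_on with
    | zero => simp only [map_zero]
    | add a b ha hb => simp only [map_add, ha, hb]
    | tmul a b =>
      change LinearMap.rTensor H (LinearMap.mul F _ (ExteriorAlgebra.ι F (trb F H V a v)))
        (sweedlerWedge F H V 1 ![w] b) = _
      rw [sweedlerWedge_succ, Jmap, LinearMap.lTensor_tmul]
      induction Coalgebra.comul (R := F) b using TensorProduct.induction_on with
      | zero => simp only [map_zero, TensorProduct.tmul_zero]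
      | add a b ha hb => simp only [map_add, TensorProduct.tmul_add, ha, hb]
      | tmul b c => simp [wedgeSweedler, sweedlerWedge, trbWedge]
  rw [sweedlerWedge_succ, LinearMap.rTensor_comp_apply, ← Coalgebra.coassoc_symm_apply]
  exact key _

theorem sweedlerWedge_two_swap
    (hcc : ∀ h : H, (TensorProduct.comm F H H) (Coalgebra.comul h) = Coalgebra.comul h)
    (v w : V) (h : H) :
    sweedlerWedge F H V 2 ![v, w] h = -sweedlerWedge F H V 2 ![w, v] h := by
  have hswap : trbWedge F H v w ∘ₗ Coalgebra.comul =
      -(trbWedge F H w v ∘ₗ Coalgebra.comul) := by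
    ext a
    have ha := trbWedge_comm v w (Coalgebra.comul (R := F) a)
    rw [hcc] at ha
    exact ha
  rw [sweedlerWedge_two, sweedlerWedge_two, hswap, LinearMap.rTensor_neg, LinearMap.neg_apply]

theorem HasJacobi.sweedlerWedge_two_cyclic {κ : V →ₗ[F] V →ₗ[F] H} (hjac : HasJacobi F H V κ)
    (x y z u : V) :
    sweedlerWedge F H V 2 ![z, u] (κ x y) + sweedlerWedge F H V 2 ![x, u] (κ y z) +
      sweedlerWedge F H V 2 ![y, u] (κ z x) = 0 := by
  have h := congrArg (wedgeSweedler F H V 1 ![u]) (hjac x y z)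
  rw [map_add, map_add, map_zero] at h
  rw [sweedlerWedge_succ, sweedlerWedge_succ, sweedlerWedge_succ]
  exact h

end SweedlerWedge

/-- A four-argument map with the antisymmetries and the cyclic identity of a curvature tensor
is symmetric under exchange of the two pairs of arguments. -/
theorem pair_symm_of_cyclic (F : Type*) {V M : Type*} [Field F] [CharZero F] [AddCommGroup M]
    [Module F M] (R : V → V → V → V → M) (hl : ∀ z u x y, R z u x y = -R u z x y)
    (hr : ∀ z u x y, R z u x y = -R z u y x)
    (hc : ∀ z u x y, R z u x y + R x u y z + R y u z x = 0) (z u x y : V) :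
    R z u x y = R x y z u := by
  have h2 : (2 : F) • (R z u x y - R x y z u) = 0 := by
    have e : (2 : F) • (R z u x y - R x y z u) =
        (R z u x y + R x u y z + R y u z x) - (R u z x y + R x z y u + R y z u x)
          + (R z x u y + R u x y z + R y x z u) - (R z y u x + R u y x z + R x y z u) := by
      rw [hl u z x y, hl x z y u, hr z x u y, hl u x y z, hl y x z u, hl z y u x, hr y z u x,
        hl u y x z, hr y u x z]
      rw [two_smul]
      abel
    rw [e, hc, hc, hc, hc]
    simp
  exact sub_eq_zero.mp ((smul_eq_zero.mp h2).resolve_left two_ne_zero)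

/-- If a linear map `κ : Λ²V → H` (encoded as an alternating bilinear
map `V × V → H`) has the Jacobi property, then `(z,u | x,y) = (x,y | z,u)` in `Λ²V ⊗ H`
for all `z, u, x, y ∈ V`, where
`(v₁,…,v_k | x,y) := (κ(x,y)₍₁₎ ▷ v₁) ∧ ⋯ ∧ (κ(x,y)₍k₎ ▷ v_k) ⊗ κ(x,y)₍k₊₁₎`. -/
theorem stmt_5 (F H V : Type*) [Field F] [CharZero F] [Ring H] [HopfAlgebra F H]
    -- cocommutativity of `H`
    (hcc : ∀ h : H, (TensorProduct.comm F H H) (Coalgebra.comul h) = Coalgebra.comul h)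
    [AddCommGroup V] [Module F V] [Module H V] [IsScalarTower F H V]
    [Module.Finite F V]
    (κ : V →ₗ[F] V →ₗ[F] H) (halt : ∀ v : V, κ v v = 0)
    (hjac : HasJacobi F H V κ) :
    ∀ z u x y : V,
      sweedlerWedge F H V 2 ![z, u] (κ x y) = sweedlerWedge F H V 2 ![x, y] (κ z u) := by
  have hanti : ∀ x y : V, κ x y = -κ y x := fun x y => by
    have h := halt (x + y)
    simp only [map_add, LinearMap.add_apply, halt, zero_add, add_zero] at h
    exact eq_neg_of_add_eq_zero_right h
  refine pair_symm_of_cyclic F (fun z u x y => sweedlerWedge F H V 2 ![z, u] (κ x y))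
    (fun z u x y => sweedlerWedge_two_swap hcc z u (κ x y)) (fun z u x y => ?_)
    (fun z u x y => hjac.sweedlerWedge_two_cyclic x y z u)
  rw [hanti x y, map_neg]
end

section
/- Let F be a field of characteristic 0, ε ∈ F, and p ∈ F[z] a polynomial. Then there exists a polynomial f ∈ F[z] satisfying f(z+ε) − f(z+ε−1) = p(z), and f is uniquely determined by this relation up to adding a constant: if f₁, f₂ ∈ F[z] both satisfy the relation, then f₁ − f₂ is a constant polynomial. -/
open Polynomial

/-- In characteristic zero the forward difference operator on polynomials is surjective. -/
theorem Polynomial.exists_comp_X_add_one_sub_self_eq {F : Type*} [Field F] [CharZero F]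
    (p : F[X]) : ∃ g : F[X], g.comp (X + 1) - g = p := by
  induction p using Polynomial.induction_on' with
  | add p q hp hq =>
    obtain ⟨g, rfl⟩ := hp
    obtain ⟨h, rfl⟩ := hq
    exact ⟨g + h, by rw [add_comp]; ring⟩
  | monomial n a =>
    have hn : (n : F) + 1 ≠ 0 := Nat.cast_add_one_ne_zero n
    have hB : ((bernoulli (n + 1)).map (algebraMap ℚ F)).comp (X + 1) =
        (bernoulli (n + 1)).map (algebraMap ℚ F) + C ((n : F) + 1) * X ^ n := by
      have h := congrArg (Polynomial.map (algebraMap ℚ F)) (bernoulli_comp_one_add_X (n + 1))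
      rw [Polynomial.map_comp, add_comm 1 X] at h
      simpa using h
    refine ⟨C (a / (n + 1)) * (bernoulli (n + 1)).map (algebraMap ℚ F), ?_⟩
    rw [mul_comp, C_comp, hB, mul_add, add_sub_cancel_left, ← mul_assoc, ← C_mul,
      div_mul_cancel₀ a hn, C_mul_X_pow_eq_monomial]

/-- In characteristic zero a polynomial invariant under translation by `1` is constant. -/
theorem Polynomial.eq_C_of_comp_X_add_one_eq_self {F : Type*} [Field F] [CharZero F]
    {h : F[X]} (hh : h.comp (X + 1) = h) : h = C (h.eval 0) := by
  have heval (n : ℕ) : h.eval (n : F) = h.eval 0 := by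
    induction n with
    | zero => simp
    | succ n ih =>
      rw [← ih]
      simpa using congrArg (eval (n : F)) hh
  refine eq_of_infinite_eval_eq _ _ ?_
  refine (Set.infinite_range_of_injective (Nat.cast_injective (R := F))).mono ?_
  rintro _ ⟨n, rfl⟩
  simpa using heval n

/-- For a field `F` of characteristic zero, `ε ∈ F` and a polynomial
`p ∈ F[z]`, there exists a polynomial `f` with `f(z+ε) − f(z+ε−1) = p(z)`, and `f` is
unique up to adding a constant. -/
theorem stmt_14 (F : Type*) [Field F] [CharZero F] (ε : F) (p : F[X]) :
    (∃ f : F[X], f.comp (X + C ε) - f.comp (X + C ε - 1) = p) ∧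
      (∀ f₁ f₂ : F[X],
        f₁.comp (X + C ε) - f₁.comp (X + C ε - 1) = p →
        f₂.comp (X + C ε) - f₂.comp (X + C ε - 1) = p →
        ∃ c : F, f₁ - f₂ = C c) := by
  constructor
  · obtain ⟨g, hg⟩ := exists_comp_X_add_one_sub_self_eq p
    refine ⟨g.comp (X + 1 - C ε), ?_⟩
    have h₁ : (X + 1 - C ε).comp (X + C ε) = X + 1 := by simp; ring
    have h₂ : (X + 1 - C ε).comp (X + C ε - 1) = X := by simp
    rw [comp_assoc, comp_assoc, h₁, h₂, comp_X, hg]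
  · intro f₁ f₂ hf₁ hf₂
    refine ⟨_, eq_C_of_comp_X_add_one_eq_self ?_⟩
    have h : (f₁ - f₂).comp (X + C ε) = (f₁ - f₂).comp (X + C ε - 1) := by
      rw [sub_comp, sub_comp]
      linear_combination hf₁ - hf₂
    have h₁ : (X + C ε).comp (X + 1 - C ε) = X + 1 := by simp
    have h₂ : (X + C ε - 1).comp (X + 1 - C ε) = X := by simp
    have h₃ := congrArg (fun q => q.comp (X + 1 - C ε)) h
    rwa [comp_assoc, comp_assoc, h₁, h₂, comp_X] at h₃
end

section
/- Let n ≥ 1 and let ξ ∈ ℂ[z] be a polynomial. Define the finite-difference operator ∇ on ℂ[z] by (∇q)(z) := q(z+1/2) − q(z−1/2), and set q(z) := (d/dz)^n (z^n·ξ(z)). Then there exists a polynomial w ∈ ℂ[z] satisfying ∇^n(z^{n−1}·w(z)) = q(z+1/2), the polynomial w is uniquely determined by this equation up to adding a constant, and if ξ ≠ 0 then deg w = deg ξ + 1. -/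
open Polynomial

namespace Polynomial

variable {K : Type*} [Field K]

/-- A linear endomorphism of `K[X]` that kills constants and lowers the degree of every
nonconstant polynomial by exactly one. -/
structure LowersDegree (L : K[X] →ₗ[K] K[X]) : Prop where
  map_C : ∀ c : K, L (C c) = 0
  degree_map : ∀ (p : K[X]) (d : ℕ), p.degree = (d + 1 : ℕ) → (L p).degree = d

namespace LowersDegree

variable {L : K[X] →ₗ[K] K[X]}

theorem degree_iterate (hL : LowersDegree L) (n : ℕ) {p : K[X]} {d : ℕ}
    (hp : p.degree = (d + n : ℕ)) : (L^[n] p).degree = d := by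
  induction n generalizing p with
  | zero => simpa using hp
  | succ n ih =>
    rw [Function.iterate_succ_apply]
    exact ih (hL.degree_map p (d + n) hp)

theorem iterate_eq_zero (hL : LowersDegree L) (n : ℕ) {p : K[X]} (hp : p.degree < n) :
    L^[n] p = 0 := by
  induction n generalizing p with
  | zero => simpa using hp
  | succ n ih =>
    rw [Function.iterate_succ_apply]
    apply ih
    rcases Nat.eq_zero_or_eq_succ_pred p.natDegree with h | h
    · rw [eq_C_of_natDegree_eq_zero h, hL.map_C, degree_zero]
      exact WithBot.bot_lt_coe n
    · have hp0 : p ≠ 0 := by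
        rintro rfl
        simp at h
      have hd : p.degree = (p.natDegree.pred + 1 : ℕ) := by
        rw [degree_eq_natDegree hp0]
        exact congrArg _ h
      rw [hL.degree_map p _ hd]
      rw [hd] at hp
      norm_cast at hp ⊢
      omega

theorem surjective (hL : LowersDegree L) : Function.Surjective L := by
  suffices h : ∀ (d : ℕ) (q : K[X]), q.degree < d → ∃ p, L p = q from
    fun q => h (q.natDegree + 1) q
      (degree_le_natDegree.trans_lt (by exact_mod_cast Nat.lt_succ_self _))
  intro d
  induction d with
  | zero =>
    intro q hq
    exact ⟨0, by rw [map_zero, eq_comm]; simpa using hq⟩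
  | succ d ih =>
    intro q hq
    have hX : (L (X ^ (d + 1))).degree = d := hL.degree_map _ d (degree_X_pow _)
    have hc : (L (X ^ (d + 1))).coeff d ≠ 0 := coeff_ne_zero_of_eq_degree hX
    set c := q.coeff d / (L (X ^ (d + 1))).coeff d with hcdef
    obtain ⟨p, hp⟩ := ih (q - c • L (X ^ (d + 1))) (by
      rw [degree_lt_iff_coeff_zero] at hq ⊢
      intro m hm
      rcases hm.eq_or_lt with rfl | hm
      · simp [hcdef, hc]
      · rw [coeff_sub, coeff_smul, hq m hm,
          coeff_eq_zero_of_degree_lt (hX.trans_lt (by exact_mod_cast hm))]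
        simp)
    exact ⟨p + c • X ^ (d + 1), by rw [map_add, map_smul, hp, sub_add_cancel]⟩

theorem exists_iterate_X_pow_mul_eq (hL : LowersDegree L) {k n : ℕ} (hk : k ≤ n) (q : K[X]) :
    ∃ w, L^[n] (X ^ k * w) = q := by
  obtain ⟨p, rfl⟩ := hL.surjective.iterate n q
  have hmonic : (X ^ k : K[X]).Monic := monic_X_pow k
  refine ⟨p /ₘ X ^ k, ?_⟩
  have hr : L^[n] (p %ₘ X ^ k) = 0 := by
    apply hL.iterate_eq_zero
    refine (degree_modByMonic_lt p hmonic).trans_le ?_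
    rw [degree_X_pow]
    exact_mod_cast hk
  conv_rhs => rw [← modByMonic_add_div p (X ^ k), iterate_map_add, hr, zero_add]

theorem natDegree_of_iterate_eq (hL : LowersDegree L) {n : ℕ} {p q : K[X]} (hq : q ≠ 0)
    (h : L^[n] p = q) : p.natDegree = q.natDegree + n := by
  have hn : n ≤ p.natDegree := by
    by_contra! hlt
    exact hq (h ▸ hL.iterate_eq_zero n
      (degree_le_natDegree.trans_lt (by exact_mod_cast hlt)))
  have hp : p ≠ 0 := by
    rintro rfl
    exact hq (by rw [← h, iterate_map_zero])
  obtain ⟨m, hm⟩ := Nat.exists_eq_add_of_le' hn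
  have := hL.degree_iterate n (p := p) (d := m) (by rw [degree_eq_natDegree hp, hm])
  rw [h] at this
  rw [natDegree_eq_of_degree_eq_some this, hm]

theorem natDegree_lt_of_iterate_eq_zero (hL : LowersDegree L) {n : ℕ} (hn : n ≠ 0) {p : K[X]}
    (h : L^[n] p = 0) : p.natDegree < n := by
  by_contra! hle
  have hp : p ≠ 0 := by
    rintro rfl
    simp at hle
    exact hn hle
  obtain ⟨m, hm⟩ := Nat.exists_eq_add_of_le' hle
  have := hL.degree_iterate n (p := p) (d := m) (by rw [degree_eq_natDegree hp, hm])
  simp [h] at this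

end LowersDegree

theorem lowersDegree_derivative [CharZero K] : LowersDegree (derivative (R := K)) where
  map_C _ := derivative_C
  degree_map p d hp := by
    have h := natDegree_eq_of_degree_eq_some hp
    rw [degree_derivative (by omega), h, Nat.add_sub_cancel]

theorem coeff_taylor_of_natDegree_le (r : K) {p : K[X]} {d : ℕ} (hp : p.natDegree ≤ d + 1) :
    (taylor r p).coeff d = p.coeff d + (d + 1) * p.coeff (d + 1) * r := by
  have hdeg : (hasseDeriv d p).natDegree < 2 :=
    (natDegree_hasseDeriv_le p d).trans_lt (by omega)
  rw [taylor_coeff, eval_eq_sum_range' hdeg]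
  simp [Finset.sum_range_succ, hasseDeriv_coeff, Nat.add_comm 1 d]

theorem lowersDegree_taylor_sub_taylor [CharZero K] {r s : K} (hrs : r ≠ s) :
    LowersDegree (taylor r - taylor s : K[X] →ₗ[K] K[X]) where
  map_C c := by simp
  degree_map p d hp := by
    have h := natDegree_eq_of_degree_eq_some hp
    have hlead : p.coeff (d + 1) ≠ 0 := coeff_ne_zero_of_eq_degree hp
    apply degree_eq_of_le_of_coeff_ne_zero
    · rw [degree_le_iff_coeff_zero]
      intro m hm
      have hm' : d < m := by exact_mod_cast hm
      rw [LinearMap.sub_apply, coeff_sub, coeff_taylor_of_natDegree_le r (by omega),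
        coeff_taylor_of_natDegree_le s (by omega),
        coeff_eq_zero_of_natDegree_lt (p := p) (n := m + 1) (by omega)]
      ring
    · rw [LinearMap.sub_apply, coeff_sub, coeff_taylor_of_natDegree_le r h.le,
        coeff_taylor_of_natDegree_le s h.le]
      have hd : (d + 1 : K) ≠ 0 := by exact_mod_cast d.succ_ne_zero
      have := mul_ne_zero (mul_ne_zero hd hlead) (sub_ne_zero.2 hrs)
      convert this using 1
      ring

end Polynomial

/-- Let `n ≥ 1` and `ξ ∈ ℂ[z]`.  With
`∇q(z) := q(z+1/2) − q(z−1/2)` and `q := (d/dz)^n (z^n ξ(z))`, there is a polynomial `w`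
with `∇^n(z^{n−1} w(z)) = q(z+1/2)`; it is unique up to adding a constant, and if `ξ ≠ 0`
then every such `w` has degree `deg ξ + 1`. -/
theorem stmt_17 (n : ℕ) (hn : 1 ≤ n) (ξ : ℂ[X]) :
    (∃ w : ℂ[X],
        (fun q : ℂ[X] => q.comp (X + C (1 / 2 : ℂ)) - q.comp (X - C (1 / 2 : ℂ)))^[n]
            (X ^ (n - 1) * w) =
          ((Polynomial.derivative)^[n] (X ^ n * ξ)).comp (X + C (1 / 2 : ℂ))) ∧
      (∀ w₁ w₂ : ℂ[X],
        (fun q : ℂ[X] => q.comp (X + C (1 / 2 : ℂ)) - q.comp (X - C (1 / 2 : ℂ)))^[n]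
            (X ^ (n - 1) * w₁) =
          ((Polynomial.derivative)^[n] (X ^ n * ξ)).comp (X + C (1 / 2 : ℂ)) →
        (fun q : ℂ[X] => q.comp (X + C (1 / 2 : ℂ)) - q.comp (X - C (1 / 2 : ℂ)))^[n]
            (X ^ (n - 1) * w₂) =
          ((Polynomial.derivative)^[n] (X ^ n * ξ)).comp (X + C (1 / 2 : ℂ)) →
        ∃ c : ℂ, w₁ - w₂ = C c) ∧
      (∀ w : ℂ[X],
        (fun q : ℂ[X] => q.comp (X + C (1 / 2 : ℂ)) - q.comp (X - C (1 / 2 : ℂ)))^[n]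
            (X ^ (n - 1) * w) =
          ((Polynomial.derivative)^[n] (X ^ n * ξ)).comp (X + C (1 / 2 : ℂ)) →
        ξ ≠ 0 → w.natDegree = ξ.natDegree + 1) := by
  have hL : LowersDegree (taylor (1 / 2) - taylor (-(1 / 2)) : ℂ[X] →ₗ[ℂ] ℂ[X]) :=
    lowersDegree_taylor_sub_taylor (by norm_num)
  have hfun : (fun q : ℂ[X] => q.comp (X + C (1 / 2 : ℂ)) - q.comp (X - C (1 / 2 : ℂ))) =
      (taylor (1 / 2) - taylor (-(1 / 2)) : ℂ[X] →ₗ[ℂ] ℂ[X]) := by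
    funext q
    rw [LinearMap.sub_apply, taylor_apply, taylor_apply, C_neg, ← sub_eq_add_neg]
  rw [hfun]
  have hX : ∀ {u : ℂ[X]}, u ≠ 0 → (X ^ (n - 1) * u).natDegree = n - 1 + u.natDegree := by
    intro u hu
    rw [natDegree_mul (pow_ne_zero _ X_ne_zero) hu, natDegree_X_pow]
  refine ⟨hL.exists_iterate_X_pow_mul_eq (Nat.sub_le n 1) _, ?_, ?_⟩
  · intro w₁ w₂ h₁ h₂
    refine ⟨(w₁ - w₂).coeff 0, eq_C_of_natDegree_eq_zero ?_⟩
    rcases eq_or_ne (w₁ - w₂) 0 with h0 | h0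
    · rw [h0, natDegree_zero]
    have h := hL.natDegree_lt_of_iterate_eq_zero (n := n) (by omega) (p := X ^ (n - 1) * (w₁ - w₂))
      (by rw [mul_sub, iterate_map_sub, h₁, h₂, sub_self])
    rw [hX h0] at h
    omega
  · intro w hw hξ
    have hdeg : (derivative^[n] (X ^ n * ξ)).degree = ξ.natDegree :=
      lowersDegree_derivative.degree_iterate n (by
        rw [degree_mul, degree_X_pow, degree_eq_natDegree hξ, add_comm]
        norm_cast)
    have hq : derivative^[n] (X ^ n * ξ) ≠ 0 := by
      intro h
      simp [h] at hdeg
    rw [← taylor_apply] at hw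
    have h := hL.natDegree_of_iterate_eq ((taylor_eq_zero _ _).not.2 hq) hw
    have hw0 : w ≠ 0 := by
      rintro rfl
      rw [mul_zero, natDegree_zero] at h
      omega
    rw [hX hw0, natDegree_taylor, natDegree_eq_of_degree_eq_some hdeg] at h
    omega
end
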